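/- Let X be a Polish space, p ≥ 1, and let C : X × P_p(ℝ^d) → [0,∞] be measurable and decreasing in the convex order in its second argument. Then for every ψ ∈ C_{b,p}(ℝ^d) one has ψ^C = (conv ψ)^C, i.e. for every x ∈ X, inf_{ρ ∈ P_p(ℝ^d)} ( ∫ψ dρ + C(x,ρ) ) = inf_{ρ ∈ P_p(ℝ^d)} ( ∫ conv ψ dρ + C(x,ρ) ). -/

import Mathlib

open MeasureTheory Set Filter Topology
open scoped ENNReal

noncomputable section

/-- `ℝ^d`, modelled as Euclidean space. -/
abbrev Rd (d : ℕ) : Type := EuclideanSpace ℝ (Fin d)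

/-- A Borel measure on `ℝ^d` has finite `p`-th moment. -/
def HasMomentP (p : ℝ) {d : ℕ} (ρ : Measure (Rd d)) : Prop :=
  ∫⁻ y, ENNReal.ofReal (‖y‖ ^ p) ∂ρ ≠ ⊤

/-- `P_p(ℝ^d)`: Borel probability measures on `ℝ^d` with finite `p`-th moment. -/
abbrev Pp (p : ℝ) (d : ℕ) : Type :=
  {ρ : Measure (Rd d) // IsProbabilityMeasure ρ ∧ HasMomentP p ρ}

/-- Continuous test functions of growth of order at most `p`. -/
def GrowthP (p : ℝ) {d : ℕ} (f : Rd d → ℝ) : Prop :=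
  Continuous f ∧ ∃ K : ℝ, ∀ y, |f y| ≤ K * (1 + ‖y‖ ^ p)

/-- The `p`-weak topology on `P_p(ℝ^d)`: the initial topology induced by integration
against continuous functions of growth of order at most `p`. -/
instance PpTopology (p : ℝ) (d : ℕ) : TopologicalSpace (Pp p d) :=
  ⨅ f : {f : Rd d → ℝ // GrowthP p f},
    TopologicalSpace.induced (fun ρ : Pp p d => ∫ y, f.1 y ∂ρ.1) inferInstance

instance PpMeasurableSpace (p : ℝ) (d : ℕ) : MeasurableSpace (Pp p d) := borel _

/-- `C_{b,p}(ℝ^d)`: continuous functions bounded from below by a constant and bounded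
above by `K (1 + |y - y₀|^p)` for some `K > 0`, `y₀`. -/
def Cbp (p : ℝ) {d : ℕ} (ψ : Rd d → ℝ) : Prop :=
  Continuous ψ ∧ (∃ c : ℝ, ∀ y, c ≤ ψ y) ∧
    ∃ K : ℝ, 0 < K ∧ ∃ y₀ : Rd d, ∀ y, ψ y ≤ K * (1 + ‖y - y₀‖ ^ p)

open scoped Classical in
/-- The nonnegative part of an extended real, as an extended nonnegative real. -/
def erealToENN (x : EReal) : ℝ≥0∞ := if x = ⊤ then ⊤ else ENNReal.ofReal x.toReal

/-- Canonical extended integral of an `EReal`-valued function: the lower integral of the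
positive part minus the lower integral of the negative part. -/
def eInt {α : Type*} [MeasurableSpace α] (μ : Measure α) (f : α → EReal) : EReal :=
  ((∫⁻ x, erealToENN (f x) ∂μ : ℝ≥0∞) : EReal) -
    ((∫⁻ x, erealToENN (-(f x)) ∂μ : ℝ≥0∞) : EReal)

/-- The convex order on measures on `ℝ^d`: `ρ₁ ≼_c ρ₂` iff `∫ f dρ₁ ≤ ∫ f dρ₂` for every
convex function `f : ℝ^d → ℝ` (integrals taken in the extended sense). -/
def ConvexOrder {d : ℕ} (ρ₁ ρ₂ : Measure (Rd d)) : Prop :=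
  ∀ f : Rd d → ℝ, ConvexOn ℝ univ f →
    eInt ρ₁ (fun y => (f y : EReal)) ≤ eInt ρ₂ (fun y => (f y : EReal))

/-- Coordinatewise increasing functions on `ℝ^d`. -/
def CoordMono {d : ℕ} (f : Rd d → ℝ) : Prop :=
  ∀ y z : Rd d, (∀ i, y i ≤ z i) → f y ≤ f z

/-- The increasing convex order on measures on `ℝ^d`. -/
def IcxOrder {d : ℕ} (ρ₁ ρ₂ : Measure (Rd d)) : Prop :=
  ∀ f : Rd d → ℝ, ConvexOn ℝ univ f → CoordMono f →
    eInt ρ₁ (fun y => (f y : EReal)) ≤ eInt ρ₂ (fun y => (f y : EReal))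

/-- `π` is a coupling of `μ` and `ν`. -/
def IsCoupling {X Y : Type*} [MeasurableSpace X] [MeasurableSpace Y]
    (π : Measure (X × Y)) (μ : Measure X) (ν : Measure Y) : Prop :=
  IsProbabilityMeasure π ∧ π.map Prod.fst = μ ∧ π.map Prod.snd = ν

open scoped Classical in
/-- Disintegration of a measure on a product space with respect to its first marginal. -/
def disint {X : Type*} [MeasurableSpace X] {Y : Type*} [MeasurableSpace Y]
    [StandardBorelSpace Y] [Nonempty Y] (π : Measure (X × Y)) :
    ProbabilityTheory.Kernel X Y :=
  if h : IsFiniteMeasure π then (haveI := h; π.condKernel) else 0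

/-- The primal weak optimal transport value `inf_{π ∈ Π(μ,ν)} ∫ C(x, π_x) dμ(x)`. -/
def primal {X : Type*} [MeasurableSpace X] {d : ℕ}
    (μ : Measure X) (ν : Measure (Rd d)) (C : X → Measure (Rd d) → ℝ≥0∞) : ℝ≥0∞ :=
  ⨅ π : {π : Measure (X × Rd d) // IsCoupling π μ ν}, ∫⁻ x, C x (disint π.1 x) ∂μ

/-- The `C`-conjugate `ψ^C (x) = inf_{ρ ∈ P_p} ρ(ψ) + C(x, ρ)`. -/
def conj (p : ℝ) {X : Type*} [MeasurableSpace X] {d : ℕ}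
    (C : X → Measure (Rd d) → ℝ≥0∞) (ψ : Rd d → ℝ) (x : X) : EReal :=
  ⨅ ρ : Pp p d, ((∫ y, ψ y ∂ρ.1 : ℝ) : EReal) + ((C x ρ.1 : ℝ≥0∞) : EReal)

/-- The dual value `μ(ψ^C) - ν(ψ)`. -/
def dualVal (p : ℝ) {X : Type*} [MeasurableSpace X] {d : ℕ}
    (μ : Measure X) (ν : Measure (Rd d)) (C : X → Measure (Rd d) → ℝ≥0∞)
    (ψ : Rd d → ℝ) : EReal :=
  eInt μ (conj p C ψ) - ((∫ y, ψ y ∂ν : ℝ) : EReal)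

end

noncomputable section

/-- The convex hull (largest convex minorant) of a function on `ℝ^d`. -/
def convHull {d : ℕ} (ψ : Rd d → ℝ) (y : Rd d) : ℝ :=
  ⨆ φ : {φ : Rd d → ℝ // ConvexOn ℝ Set.univ φ ∧ ∀ z, φ z ≤ ψ z}, φ.1 y

end

open ProbabilityTheory

section Moments

variable {d : ℕ} {p : ℝ}

lemma hasMomentP_iff_memLp (hp : 1 ≤ p) (ρ : Measure (Rd d)) :
    HasMomentP p ρ ↔ MemLp id (ENNReal.ofReal p) ρ := by
  have hp0 : 0 < p := by linarith
  have h0 : ENNReal.ofReal p ≠ 0 := by simpa using hp0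
  have h : eLpNorm id (ENNReal.ofReal p) ρ < ∞ ↔ HasMomentP p ρ := by
    rw [eLpNorm_lt_top_iff_lintegral_rpow_enorm_lt_top h0 ENNReal.ofReal_ne_top, HasMomentP,
      ENNReal.toReal_ofReal hp0.le, lt_top_iff_ne_top]
    simp only [← ENNReal.ofReal_rpow_of_nonneg (norm_nonneg _) hp0.le, id, ofReal_norm]
  rw [← h]
  exact ⟨fun h => ⟨aestronglyMeasurable_id, h⟩, fun h => h.2⟩

lemma Cbp.integrable (hp : 1 ≤ p) {ψ : Rd d → ℝ} (hψ : Cbp p ψ) {ρ : Measure (Rd d)}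
    [IsProbabilityMeasure ρ] (hρ : MemLp id (ENNReal.ofReal p) ρ) : Integrable ψ ρ := by
  obtain ⟨hcont, ⟨c, hc⟩, K, hK0, y₀, hK⟩ := hψ
  have h := (hρ.sub (memLp_const y₀)).integrable_norm_rpow'
  rw [ENNReal.toReal_ofReal (by linarith)] at h
  refine Integrable.mono' ((((integrable_const 1).add h).const_mul K).add (integrable_const |c|))
    hcont.aestronglyMeasurable (.of_forall fun y => ?_)
  have h1 := hK y
  have h2 := hc y
  simp only [Pi.add_apply, Pi.sub_apply, id, Real.norm_eq_abs]
  rw [abs_le]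
  have := neg_abs_le c
  have hn := abs_nonneg c
  constructor
  · have h3 : 0 ≤ ‖y - y₀‖ ^ p := by positivity
    have : 0 ≤ K * (1 + ‖y - y₀‖ ^ p) := by positivity
    linarith
  · linarith

lemma integrable_of_continuous_of_ae_norm_le {f : Rd d → ℝ} (hf : Continuous f)
    {m : Measure (Rd d)} [IsFiniteMeasure m] {R : ℝ} (hR : ∀ᵐ v ∂m, ‖v‖ ≤ R) :
    Integrable f m := by
  obtain ⟨B, hB⟩ := (isCompact_closedBall (0 : Rd d) R).exists_bound_of_continuousOn
    hf.continuousOn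
  exact Integrable.of_bound hf.aestronglyMeasurable B
    (hR.mono fun v hv => hB v (by simpa using hv))

lemma integrable_id_of_ae_norm_le {m : Measure (Rd d)} [IsFiniteMeasure m] {R : ℝ}
    (hR : ∀ᵐ v ∂m, ‖v‖ ≤ R) : Integrable (fun v : Rd d => v) m :=
  Integrable.of_bound aestronglyMeasurable_id R hR

end Moments

section ConvexOrder

variable {d : ℕ}

lemma ConvexOn.continuous_rd {f : Rd d → ℝ} (hf : ConvexOn ℝ univ f) : Continuous f :=
  hf.locallyLipschitz.continuous

lemma ConvexOn.exists_affine_minorant {f : Rd d → ℝ} (hf : ConvexOn ℝ univ f) :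
    ∃ (l : Rd d →L[ℝ] ℝ) (c : ℝ), ∀ y, l y + c ≤ f y := by
  obtain ⟨l, c, h, -⟩ :=
    hf.real_univ_sSup_of_nat_affine_eq hf.continuous_rd.lowerSemicontinuous
  exact ⟨l 0, c 0, fun y => h 0 y⟩

lemma erealToENN_coe (a : ℝ) : erealToENN (a : EReal) = ENNReal.ofReal a := by
  simp [erealToENN]

lemma eInt_coe (μ : Measure (Rd d)) (f : Rd d → ℝ) :
    eInt μ (fun y => (f y : EReal)) =
      ((∫⁻ y, ENNReal.ofReal (f y) ∂μ : ℝ≥0∞) : EReal) -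
        ((∫⁻ y, ENNReal.ofReal (-f y) ∂μ : ℝ≥0∞) : EReal) := by
  simp only [eInt, ← EReal.coe_neg, erealToENN_coe]

lemma eInt_coe_of_integrable {μ : Measure (Rd d)} {f : Rd d → ℝ} (hf : Integrable f μ) :
    eInt μ (fun y => (f y : EReal)) = ((∫ y, f y ∂μ : ℝ) : EReal) := by
  have h1 := hf.lintegral_lt_top.ne
  have h2 := hf.neg.lintegral_lt_top.ne
  simp only [Pi.neg_apply] at h2
  rw [eInt_coe, integral_eq_lintegral_pos_part_sub_lintegral_neg_part hf, EReal.coe_sub,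
    EReal.coe_ennreal_toReal h1, EReal.coe_ennreal_toReal h2]

lemma eInt_coe_of_not_integrable {μ : Measure (Rd d)} {f g : Rd d → ℝ} (hf : Measurable f)
    (hg : Integrable g μ) (hgf : ∀ y, g y ≤ f y) (hnf : ¬ Integrable f μ) :
    eInt μ (fun y => (f y : EReal)) = ⊤ := by
  have h2 : ∫⁻ y, ENNReal.ofReal (-f y) ∂μ ≠ ⊤ := by
    refine ne_top_of_le_ne_top hg.neg.lintegral_lt_top.ne (lintegral_mono fun y => ?_)
    exact ENNReal.ofReal_le_ofReal (neg_le_neg (hgf y))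
  have h1 : ∫⁻ y, ENNReal.ofReal (f y) ∂μ = ⊤ := by
    by_contra h1
    refine hnf ⟨hf.aestronglyMeasurable, ?_⟩
    rw [hasFiniteIntegral_iff_norm]
    calc ∫⁻ y, ENNReal.ofReal ‖f y‖ ∂μ
        ≤ ∫⁻ y, (ENNReal.ofReal (f y) + ENNReal.ofReal (-f y)) ∂μ := by
          refine lintegral_mono fun y => ?_
          rcases le_total 0 (f y) with h | h
          · simp [abs_of_nonneg h]
          · simp [abs_of_nonpos h]
      _ = ∫⁻ y, ENNReal.ofReal (f y) ∂μ + ∫⁻ y, ENNReal.ofReal (-f y) ∂μ :=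
          lintegral_add_left hf.ennreal_ofReal _
      _ < ⊤ := ENNReal.add_lt_top.2 ⟨lt_top_iff_ne_top.2 h1, lt_top_iff_ne_top.2 h2⟩
  rw [eInt_coe, h1]
  lift ∫⁻ y, ENNReal.ofReal (-f y) ∂μ to NNReal using h2 with a
  exact EReal.top_sub_coe a

/-- The law of `Y + V`, where `Y` has law `ρ` and `V` has law `κ Y` given `Y`. -/
noncomputable def spread (ρ : Measure (Rd d)) (κ : Kernel (Rd d) (Rd d)) : Measure (Rd d) :=
  (ρ ⊗ₘ κ).map (fun q => q.1 + q.2)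

instance (ρ : Measure (Rd d)) [IsProbabilityMeasure ρ] (κ : Kernel (Rd d) (Rd d))
    [IsMarkovKernel κ] : IsProbabilityMeasure (spread ρ κ) :=
  Measure.isProbabilityMeasure_map (by fun_prop)

lemma memLp_spread {ρ : Measure (Rd d)} [IsProbabilityMeasure ρ] {κ : Kernel (Rd d) (Rd d)}
    [IsMarkovKernel κ] {R : ℝ} (hR : ∀ y, ∀ᵐ v ∂κ y, ‖v‖ ≤ R) {q : ℝ≥0∞}
    (hρ : MemLp id q ρ) : MemLp id q (spread ρ κ) := by
  rw [spread, memLp_map_measure_iff aestronglyMeasurable_id (by fun_prop)]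
  have h1 : MemLp (fun z : Rd d × Rd d => z.1) q (ρ ⊗ₘ κ) := by
    have : MemLp id q ((ρ ⊗ₘ κ).map Prod.fst) := by
      have h := Measure.fst_compProd ρ κ
      rw [Measure.fst] at h
      rwa [h]
    exact (memLp_map_measure_iff aestronglyMeasurable_id (by fun_prop)).1 this
  have h2 : MemLp (fun z : Rd d × Rd d => z.2) q (ρ ⊗ₘ κ) := by
    refine MemLp.of_bound (by fun_prop) R ?_
    exact Measure.ae_compProd_of_ae_ae
      (measurableSet_le (by fun_prop) (by fun_prop)) (.of_forall hR)
  exact h1.add h2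

lemma integrable_comp_add_of_integrable_spread {ρ : Measure (Rd d)}
    {κ : Kernel (Rd d) (Rd d)} {f : Rd d → ℝ} (hf : Integrable f (spread ρ κ)) :
    Integrable (fun z : Rd d × Rd d => f (z.1 + z.2)) (ρ ⊗ₘ κ) :=
  (integrable_map_measure hf.aestronglyMeasurable (by fun_prop)).1 hf

lemma integral_spread {ρ : Measure (Rd d)} [IsProbabilityMeasure ρ]
    {κ : Kernel (Rd d) (Rd d)} [IsMarkovKernel κ] {f : Rd d → ℝ}
    (hf : Integrable f (spread ρ κ)) :
    ∫ y, f y ∂spread ρ κ = ∫ y, ∫ v, f (y + v) ∂κ y ∂ρ := by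
  rw [← Measure.integral_compProd (f := fun z : Rd d × Rd d => f (z.1 + z.2))
    (integrable_comp_add_of_integrable_spread hf)]
  exact integral_map (by fun_prop) hf.aestronglyMeasurable

lemma ConvexOn.le_integral_add {f : Rd d → ℝ} (hf : ConvexOn ℝ univ f) {η : Measure (Rd d)}
    [IsProbabilityMeasure η] {R : ℝ} (hR : ∀ᵐ v ∂η, ‖v‖ ≤ R) (h0 : ∫ v, v ∂η = 0)
    (y : Rd d) : f y ≤ ∫ v, f (y + v) ∂η := by
  have hid := integrable_id_of_ae_norm_le hR
  have hcont := hf.continuous_rd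
  have h := hf.map_integral_le (μ := η) (f := fun v => y + v) hcont.continuousOn isClosed_univ
    (by simp) ((integrable_const y).add hid)
    (integrable_of_continuous_of_ae_norm_le (f := fun v => f (y + v)) (by fun_prop) hR)
  rwa [integral_add (integrable_const y) hid, h0, integral_const, probReal_univ, one_smul,
    add_zero] at h

/-- Spreading mass by centered noise increases a measure in the convex order. -/
lemma convexOrder_spread {ρ : Measure (Rd d)} [IsProbabilityMeasure ρ]
    {κ : Kernel (Rd d) (Rd d)} [IsMarkovKernel κ] {R : ℝ}
    (hR : ∀ y, ∀ᵐ v ∂κ y, ‖v‖ ≤ R) (h0 : ∀ y, ∫ v, v ∂κ y = 0)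
    (hρ : Integrable (fun y : Rd d => y) ρ) : ConvexOrder ρ (spread ρ κ) := by
  intro f hf
  have hcont := hf.continuous_rd
  obtain ⟨l, c, hl⟩ := hf.exists_affine_minorant
  have haff : ∀ m : Measure (Rd d), IsProbabilityMeasure m → Integrable (fun y : Rd d => y) m →
      Integrable (fun y => l y + c) m := fun m _ hm =>
    (l.integrable_comp hm).add (integrable_const c)
  have hρ' : Integrable (fun y : Rd d => y) (spread ρ κ) :=
    memLp_one_iff_integrable.1 (memLp_spread hR (memLp_one_iff_integrable.2 hρ))
  by_cases hfi : Integrable f (spread ρ κ)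
  · have hF : Integrable (fun y => ∫ v, f (y + v) ∂κ y) ρ := by
      simpa using (integrable_comp_add_of_integrable_spread hfi).integral_compProd
    have hle : ∀ y, f y ≤ ∫ v, f (y + v) ∂κ y := fun y => hf.le_integral_add (hR y) (h0 y) y
    have hfρ : Integrable f ρ :=
      integrable_of_le_of_le hcont.aestronglyMeasurable (.of_forall hl) (.of_forall hle)
        (haff ρ inferInstance hρ) hF
    rw [eInt_coe_of_integrable hfρ, eInt_coe_of_integrable hfi, EReal.coe_le_coe_iff,
      integral_spread hfi]
    exact integral_mono hfρ hF hle
  · rw [eInt_coe_of_not_integrable hcont.measurable (haff _ inferInstance hρ') hl hfi]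
    exact le_top

end ConvexOrder

section ConvexHull

variable {d : ℕ}

/-- `m` is a probability measure with bounded support and barycenter `y`. -/
structure IsBary (y : Rd d) (m : Measure (Rd d)) : Prop where
  prob : IsProbabilityMeasure m
  bdd : ∃ R : ℝ, ∀ᵐ z ∂m, ‖z‖ ≤ R
  mean : ∫ z, z ∂m = y

lemma isBary_dirac (y : Rd d) : IsBary y (Measure.dirac y) :=
  ⟨inferInstance, ⟨‖y‖, by simp⟩, by simp⟩

lemma IsBary.integrable {y : Rd d} {m : Measure (Rd d)} (hm : IsBary y m) {f : Rd d → ℝ}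
    (hf : Continuous f) : Integrable f m := by
  obtain ⟨_, ⟨R, hR⟩, -⟩ := hm
  exact integrable_of_continuous_of_ae_norm_le hf hR

lemma IsBary.integrable_id {y : Rd d} {m : Measure (Rd d)} (hm : IsBary y m) :
    Integrable (fun z : Rd d => z) m := by
  obtain ⟨_, ⟨R, hR⟩, -⟩ := hm
  exact integrable_id_of_ae_norm_le hR

lemma IsBary.le_integral {y : Rd d} {m : Measure (Rd d)} (hm : IsBary y m) {f : Rd d → ℝ}
    (hf : Continuous f) {c : ℝ} (hc : ∀ z, c ≤ f z) : c ≤ ∫ z, f z ∂m := by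
  have := hm.prob
  simpa using integral_mono (integrable_const c) (hm.integrable hf) hc

lemma IsBary.combine {y₁ y₂ : Rd d} {m₁ m₂ : Measure (Rd d)} (h₁ : IsBary y₁ m₁)
    (h₂ : IsBary y₂ m₂) {a b : ℝ} (ha : 0 ≤ a) (hb : 0 ≤ b) (hab : a + b = 1) :
    IsBary (a • y₁ + b • y₂) (ENNReal.ofReal a • m₁ + ENNReal.ofReal b • m₂) := by
  have := h₁.prob
  have := h₂.prob
  refine ⟨⟨?_⟩, ?_, ?_⟩
  · simp [← ENNReal.ofReal_add ha hb, hab]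
  · obtain ⟨R₁, hR₁⟩ := h₁.bdd
    obtain ⟨R₂, hR₂⟩ := h₂.bdd
    refine ⟨max R₁ R₂, ?_⟩
    rw [ae_add_measure_iff]
    exact ⟨Measure.ae_smul_measure (hR₁.mono fun z hz => hz.trans (le_max_left _ _)) _,
      Measure.ae_smul_measure (hR₂.mono fun z hz => hz.trans (le_max_right _ _)) _⟩
  · rw [integral_add_measure (h₁.integrable_id.smul_measure ENNReal.ofReal_ne_top)
      (h₂.integrable_id.smul_measure ENNReal.ofReal_ne_top), integral_smul_measure,
      integral_smul_measure, h₁.mean, h₂.mean, ENNReal.toReal_ofReal ha,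
      ENNReal.toReal_ofReal hb]

lemma IsBary.integral_combine {y₁ y₂ : Rd d} {m₁ m₂ : Measure (Rd d)} (h₁ : IsBary y₁ m₁)
    (h₂ : IsBary y₂ m₂) {a b : ℝ} (ha : 0 ≤ a) (hb : 0 ≤ b) {f : Rd d → ℝ}
    (hf : Continuous f) :
    ∫ z, f z ∂(ENNReal.ofReal a • m₁ + ENNReal.ofReal b • m₂) =
      a * ∫ z, f z ∂m₁ + b * ∫ z, f z ∂m₂ := by
  rw [integral_add_measure ((h₁.integrable hf).smul_measure ENNReal.ofReal_ne_top)
    ((h₂.integrable hf).smul_measure ENNReal.ofReal_ne_top), integral_smul_measure,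
    integral_smul_measure, ENNReal.toReal_ofReal ha, ENNReal.toReal_ofReal hb, smul_eq_mul,
    smul_eq_mul]

lemma convHull_le {ψ : Rd d → ℝ} {c : ℝ} (hc : ∀ z, c ≤ ψ z) (y : Rd d) :
    convHull ψ y ≤ ψ y :=
  have : Nonempty {φ : Rd d → ℝ // ConvexOn ℝ univ φ ∧ ∀ z, φ z ≤ ψ z} :=
    ⟨⟨fun _ => c, convexOn_const c convex_univ, hc⟩⟩
  ciSup_le fun φ => φ.2.2 y

lemma le_convHull {ψ φ : Rd d → ℝ} (hφ : ConvexOn ℝ univ φ) (hle : ∀ z, φ z ≤ ψ z)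
    (y : Rd d) : φ y ≤ convHull ψ y :=
  le_ciSup (f := fun φ : {φ : Rd d → ℝ // ConvexOn ℝ univ φ ∧ ∀ z, φ z ≤ ψ z} => φ.1 y)
    ⟨ψ y, by rintro _ ⟨φ, rfl⟩; exact φ.2.2 y⟩ ⟨φ, hφ, hle⟩

lemma convexOn_convHull {ψ : Rd d → ℝ} {c : ℝ} (hc : ∀ z, c ≤ ψ z) :
    ConvexOn ℝ univ (convHull ψ) := by
  have : Nonempty {φ : Rd d → ℝ // ConvexOn ℝ univ φ ∧ ∀ z, φ z ≤ ψ z} :=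
    ⟨⟨fun _ => c, convexOn_const c convex_univ, hc⟩⟩
  refine ⟨convex_univ, fun y₁ _ y₂ _ a b ha hb hab => ciSup_le fun φ => ?_⟩
  refine (φ.2.1.2 (mem_univ y₁) (mem_univ y₂) ha hb hab).trans ?_
  have h₁ := le_convHull φ.2.1 φ.2.2 y₁
  have h₂ := le_convHull φ.2.1 φ.2.2 y₂
  gcongr

/-- The convex hull is approximated by averages over measures with given barycenter. -/
lemma exists_isBary_integral_lt {ψ : Rd d → ℝ} (hψ : Continuous ψ) {c : ℝ}
    (hc : ∀ z, c ≤ ψ z) (y : Rd d) {ε : ℝ} (hε : 0 < ε) :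
    ∃ m, IsBary y m ∧ ∫ z, ψ z ∂m < convHull ψ y + ε := by
  set h : Rd d → ℝ := fun y => ⨅ m : {m : Measure (Rd d) // IsBary y m}, ∫ z, ψ z ∂m.1 with hh
  have hne : ∀ y, Nonempty {m : Measure (Rd d) // IsBary y m} := fun y => ⟨⟨_, isBary_dirac y⟩⟩
  have hbdd : ∀ y, BddBelow (range fun m : {m : Measure (Rd d) // IsBary y m} =>
      ∫ z, ψ z ∂m.1) := by
    rintro y
    refine ⟨c, ?_⟩
    rintro _ ⟨m, rfl⟩
    exact m.2.le_integral hψ hc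
  have hlt : ∀ y, ∀ δ > 0, ∃ m, IsBary y m ∧ ∫ z, ψ z ∂m < h y + δ := by
    intro y δ hδ
    obtain ⟨m, hm⟩ := exists_lt_of_ciInf_lt (show h y < h y + δ by linarith)
    exact ⟨m.1, m.2, hm⟩
  have hle : ∀ y m, IsBary y m → h y ≤ ∫ z, ψ z ∂m := fun y m hm => ciInf_le (hbdd y) ⟨m, hm⟩
  have hconv : ConvexOn ℝ univ h := by
    refine ⟨convex_univ, fun y₁ _ y₂ _ a b ha hb hab => le_of_forall_pos_le_add fun δ hδ => ?_⟩
    obtain ⟨m₁, hm₁, hl₁⟩ := hlt y₁ δ hδ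
    obtain ⟨m₂, hm₂, hl₂⟩ := hlt y₂ δ hδ
    refine (hle _ _ (hm₁.combine hm₂ ha hb hab)).trans ?_
    rw [hm₁.integral_combine hm₂ ha hb hψ, smul_eq_mul, smul_eq_mul]
    calc a * ∫ z, ψ z ∂m₁ + b * ∫ z, ψ z ∂m₂ ≤ a * (h y₁ + δ) + b * (h y₂ + δ) := by gcongr
      _ = a * h y₁ + b * h y₂ + (a + b) * δ := by ring
      _ = a * h y₁ + b * h y₂ + δ := by rw [hab, one_mul]
  have hψh : ∀ z, h z ≤ ψ z := fun z => by simpa using hle z _ (isBary_dirac z)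
  obtain ⟨m, hm, hlm⟩ := hlt y ε hε
  exact ⟨m, hm, hlm.trans_le (by have := le_convHull hconv hψh y; linarith)⟩

lemma exists_isBary_zero_integral_add_lt {ψ : Rd d → ℝ} (hψ : Continuous ψ) {c : ℝ}
    (hc : ∀ z, c ≤ ψ z) (y : Rd d) {ε : ℝ} (hε : 0 < ε) :
    ∃ η, IsBary 0 η ∧ ∫ v, ψ (y + v) ∂η < convHull ψ y + ε := by
  obtain ⟨m, hm, hlt⟩ := exists_isBary_integral_lt hψ hc y hε
  have := hm.prob
  have hmeas : Measurable fun z : Rd d => z - y := by fun_prop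
  refine ⟨m.map (fun z => z - y), ⟨Measure.isProbabilityMeasure_map hmeas.aemeasurable, ?_, ?_⟩,
    ?_⟩
  · obtain ⟨R, hR⟩ := hm.bdd
    refine ⟨R + ‖y‖, ?_⟩
    rw [ae_map_iff hmeas.aemeasurable (measurableSet_le (by fun_prop) (by fun_prop))]
    exact hR.mono fun z hz => (norm_sub_le z y).trans (by linarith)
  · rw [integral_map hmeas.aemeasurable (f := fun z => z) aestronglyMeasurable_id,
      integral_sub hm.integrable_id (integrable_const y), hm.mean]
    simp
  · rw [integral_map hmeas.aemeasurable
      (Continuous.aestronglyMeasurable (f := fun v => ψ (y + v)) (by fun_prop))]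
    simpa using hlt

lemma IsBary.continuous_integral_add {y : Rd d} {η : Measure (Rd d)} (hη : IsBary y η)
    {ψ : Rd d → ℝ} (hψ : Continuous ψ) : Continuous fun z => ∫ v, ψ (z + v) ∂η := by
  have := hη.prob
  obtain ⟨R, hR⟩ := hη.bdd
  refine continuous_iff_continuousAt.2 fun z₀ => ?_
  obtain ⟨B, hB⟩ := (isCompact_closedBall z₀ (1 + R)).exists_bound_of_continuousOn
    hψ.continuousOn
  refine continuousAt_of_dominated (bound := fun _ => B)
    (.of_forall fun z => Continuous.aestronglyMeasurable (by fun_prop)) ?_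
    (integrable_const B) (.of_forall fun v => by fun_prop)
  filter_upwards [Metric.ball_mem_nhds z₀ one_pos] with z hz
  filter_upwards [hR] with v hv
  refine hB _ ?_
  rw [Metric.mem_ball, dist_eq_norm] at hz
  rw [Metric.mem_closedBall, dist_eq_norm, add_sub_right_comm]
  exact (norm_add_le _ _).trans (add_le_add hz.le hv)

end ConvexHull

section Selection

variable {d : ℕ} {p : ℝ}

/-- A measurable selection among countably many centered noises that nearly realizes the
convex hull. -/
lemma exists_measurable_selection {ψ : Rd d → ℝ} (hψ : Continuous ψ) {c : ℝ}
    (hc : ∀ z, c ≤ ψ z) {ε : ℝ} (hε : 0 < ε) :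
    ∃ (η : ℕ → Measure (Rd d)) (i : Rd d → ℕ), Measurable i ∧ (∀ n, IsBary 0 (η n)) ∧
      ∀ y, ∫ v, ψ (y + v) ∂η (i y) ≤ convHull ψ y + ε := by
  classical
  choose η hη hlt using fun y => exists_isBary_zero_integral_add_lt hψ hc y hε
  have hcc := (convexOn_convHull hc).continuous_rd
  have hopen : ∀ y, IsOpen {z | ∫ v, ψ (z + v) ∂η y < convHull ψ z + ε} := fun y =>
    isOpen_lt ((hη y).continuous_integral_add hψ) (by fun_prop)
  obtain ⟨s, hs, hU⟩ := TopologicalSpace.countable_cover_nhds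
    (f := fun y => {z | ∫ v, ψ (z + v) ∂η y < convHull ψ z + ε})
    (fun y => (hopen y).mem_nhds (hlt y))
  have hsne : s.Nonempty := by
    by_contra hne
    rw [not_nonempty_iff_eq_empty] at hne
    simp only [hne, mem_empty_iff_false, iUnion_of_empty, iUnion_empty] at hU
    exact empty_ne_univ hU
  obtain ⟨u, rfl⟩ := hs.exists_eq_range hsne
  have hex : ∀ z, ∃ n, ∫ v, ψ (z + v) ∂η (u n) < convHull ψ z + ε := fun z => by
    have : z ∈ ⋃ y ∈ range u, {z | ∫ v, ψ (z + v) ∂η y < convHull ψ z + ε} := hU ▸ mem_univ z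
    simpa using this
  exact ⟨fun n => η (u n), fun z => Nat.find (hex z),
    measurable_find hex fun n => (hopen (u n)).measurableSet, fun n => hη (u n),
    fun z => (Nat.find_spec (hex z)).le⟩

/-- Every `ρ` is dominated in the convex order by some `ρ'` whose `ψ`-integral nearly attains the
integral of `convHull ψ` against `ρ`. -/
lemma exists_convexOrder_integral_le (hp : 1 ≤ p) {ψ : Rd d → ℝ} (hψ : Cbp p ψ) (ρ : Pp p d)
    {ε : ℝ} (hε : 0 < ε) :
    ∃ ρ' : Pp p d, ConvexOrder ρ.1 ρ'.1 ∧
      ∫ y, ψ y ∂ρ'.1 ≤ ∫ y, convHull ψ y ∂ρ.1 + ε := by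
  obtain ⟨ρ, hprob, hmom⟩ := ρ
  have hmem := (hasMomentP_iff_memLp hp ρ).1 hmom
  have hcont := hψ.1
  obtain ⟨c, hc⟩ := hψ.2.1
  have hψρ := hψ.integrable hp hmem
  have hcc := (convexOn_convHull hc).continuous_rd
  have hcle : ∀ y, c ≤ convHull ψ y := le_convHull (convexOn_const c convex_univ) hc
  have hCρ : Integrable (convHull ψ) ρ :=
    integrable_of_le_of_le hcc.aestronglyMeasurable (.of_forall hcle)
      (.of_forall (convHull_le hc)) (integrable_const c) hψρ
  have hε2 : 0 < ε / 2 := by linarith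
  obtain ⟨η, i, hi, hη, hle⟩ := exists_measurable_selection hcont hc hε2
  have (n : ℕ) : IsProbabilityMeasure (η n) := (hη n).prob
  let ζ : ℕ → ℕ → Measure (Rd d) := fun N n => if n ≤ N then η n else Measure.dirac 0
  have hζ : ∀ N n, IsBary 0 (ζ N n) := fun N n => by
    by_cases h : n ≤ N
    · simpa [ζ, h] using hη n
    · simpa [ζ, h] using isBary_dirac (0 : Rd d)
  let κ : ℕ → Kernel (Rd d) (Rd d) := fun N => (Kernel.ofFunOfCountable (ζ N)).comap i hi
  have hκ : ∀ N y, κ N y = ζ N (i y) := fun N y => rfl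
  have hmarkov (N : ℕ) : IsMarkovKernel (κ N) := ⟨fun y => (hζ N (i y)).prob⟩
  have hbound : ∀ N, ∃ R : ℝ, ∀ y, ∀ᵐ v ∂κ N y, ‖v‖ ≤ R := by
    intro N
    choose r hr using fun n => (hη n).bdd
    refine ⟨∑ n ∈ Finset.range (N + 1), |r n|, fun y => ?_⟩
    rw [hκ]
    by_cases h : i y ≤ N
    · simp only [ζ, h, if_true]
      refine (hr (i y)).mono fun v hv => hv.trans ((le_abs_self _).trans ?_)
      exact Finset.single_le_sum (f := fun n => |r n|) (fun n _ => abs_nonneg _)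
        (Finset.mem_range.2 (by lia))
    · simp only [ζ, h, if_false]
      rw [ae_dirac_eq]
      simpa using Finset.sum_nonneg fun n _ => abs_nonneg (r n)
  choose R hR using hbound
  have hmem' : ∀ N, MemLp id (ENNReal.ofReal p) (spread ρ (κ N)) := fun N =>
    memLp_spread (hR N) hmem
  have hψint : ∀ N, Integrable ψ (spread ρ (κ N)) := fun N => hψ.integrable hp (hmem' N)
  let g : ℕ → Rd d → ℝ := fun N y => ∫ v, ψ (y + v) ∂κ N y
  have hgint : ∀ N, Integrable (g N) ρ := fun N => by
    simpa using (integrable_comp_add_of_integrable_spread (hψint N)).integral_compProd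
  have hgc : ∀ N y, c ≤ g N y := fun N y =>
    (hζ N (i y)).le_integral (f := fun v => ψ (y + v)) (by fun_prop) fun v => hc _
  have hgψ : ∀ N y, g N y ≤ ψ y + ε / 2 := fun N y => by
    simp only [g, hκ, ζ]
    split_ifs with h
    · exact (hle y).trans (by have := convHull_le hc y; linarith)
    · simpa using hε2.le
  have hlim : ∀ y, Tendsto (fun N => g N y) atTop (𝓝 (∫ v, ψ (y + v) ∂η (i y))) := fun y => by
    refine tendsto_const_nhds.congr' ?_
    filter_upwards [eventually_ge_atTop (i y)] with N hN
    simp [g, hκ, ζ, hN]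
  have hG : Tendsto (fun N => ∫ y, g N y ∂ρ) atTop
      (𝓝 (∫ y, ∫ v, ψ (y + v) ∂η (i y) ∂ρ)) := by
    refine tendsto_integral_of_dominated_convergence (fun y => |ψ y + ε / 2| + |c|)
      (fun N => (hgint N).aestronglyMeasurable)
      ((hψρ.add (integrable_const _)).abs.add (integrable_const _)) (fun N => .of_forall fun y => ?_)
      (.of_forall hlim)
    rw [Real.norm_eq_abs, abs_le]
    have h1 := hgc N y
    have h2 := hgψ N y
    have h3 := neg_abs_le c
    have h4 := le_abs_self (ψ y + ε / 2)
    have h5 := abs_nonneg c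
    have h6 := abs_nonneg (ψ y + ε / 2)
    constructor <;> linarith
  have hGle : ∫ y, ∫ v, ψ (y + v) ∂η (i y) ∂ρ ≤ ∫ y, convHull ψ y ∂ρ + ε / 2 := by
    have hint : Integrable (fun y => ∫ v, ψ (y + v) ∂η (i y)) ρ :=
      integrable_of_le_of_le
        (aestronglyMeasurable_of_tendsto_ae atTop (fun N => (hgint N).aestronglyMeasurable)
          (.of_forall hlim))
        (.of_forall fun y => (hη (i y)).le_integral (f := fun v => ψ (y + v)) (by fun_prop)
          fun v => hc _)
        (.of_forall hle) (integrable_const c) (hCρ.add (integrable_const _))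
    refine (integral_mono hint (hCρ.add (integrable_const _)) hle).trans_eq ?_
    simp [integral_add hCρ (integrable_const _)]
  obtain ⟨N, hN⟩ := (hG.eventually_lt_const
    (show _ < ∫ y, convHull ψ y ∂ρ + ε by linarith)).exists
  refine ⟨⟨spread ρ (κ N), inferInstance, (hasMomentP_iff_memLp hp _).2 (hmem' N)⟩,
    convexOrder_spread (hR N) (fun y => (hζ N (i y)).mean) ?_, ?_⟩
  · exact memLp_one_iff_integrable.1 (hmem.mono_exponent (by simpa using hp))
  · exact (integral_spread (hψint N)).trans_le hN.le

end Selection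

/-- **Stability of the `C`-conjugate under taking convex hulls** (Lemma 3, convex case):
if `C` is measurable and `≼_c`-decreasing in its second argument, then
`ψ^C = (conv ψ)^C` for every `ψ ∈ C_{b,p}(ℝ^d)`. -/
theorem conj_convHull_eq
    {X : Type*} [TopologicalSpace X] [PolishSpace X] [MeasurableSpace X] [BorelSpace X]
    {d : ℕ} {p : ℝ} (hp : 1 ≤ p)
    (C : X → Measure (Rd d) → ℝ≥0∞)
    (hmeas : Measurable fun q : X × Pp p d => C q.1 q.2.1)
    (hmono : ∀ x : X, ∀ ρ₁ ρ₂ : Pp p d, ConvexOrder ρ₁.1 ρ₂.1 → C x ρ₂.1 ≤ C x ρ₁.1)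
    (ψ : Rd d → ℝ) (hψ : Cbp p ψ) (x : X) :
    conj p C ψ x = conj p C (convHull ψ) x := by
  obtain ⟨c, hc⟩ := hψ.2.1
  have hcle : ∀ y, c ≤ convHull ψ y := le_convHull (convexOn_const c convex_univ) hc
  refine le_antisymm (le_iInf fun ρ => ?_) (le_iInf fun ρ => ?_)
  · refine EReal.le_of_forall_lt_iff_le.1 fun z hz => ?_
    rcases eq_or_ne (C x ρ.1) ⊤ with hC | hC
    · simp [hC] at hz
    lift C x ρ.1 to NNReal using hC with b hb
    replace hz : ∫ y, convHull ψ y ∂ρ.1 < z - (b : ℝ) := by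
      rw [EReal.coe_nnreal_eq_coe_real, ← EReal.coe_add, EReal.coe_lt_coe_iff] at hz
      linarith
    obtain ⟨ρ', hord, hle⟩ := exists_convexOrder_integral_le hp hψ ρ (sub_pos.2 hz)
    refine (iInf_le _ ρ').trans ?_
    calc ((∫ y, ψ y ∂ρ'.1 : ℝ) : EReal) + ((C x ρ'.1 : ℝ≥0∞) : EReal)
        ≤ ((z - b : ℝ) : EReal) + ((b : ℝ) : EReal) := by
          refine add_le_add (EReal.coe_le_coe_iff.2 (by linarith)) ?_
          have h := hmono x ρ ρ' hord
          rw [← hb] at h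
          rw [← EReal.coe_nnreal_eq_coe_real]
          exact EReal.coe_ennreal_le_coe_ennreal_iff.2 h
      _ = z := by rw [← EReal.coe_add, sub_add_cancel]
  · have := ρ.2.1
    have hψρ := hψ.integrable hp ((hasMomentP_iff_memLp hp ρ.1).1 ρ.2.2)
    have hCρ : Integrable (convHull ψ) ρ.1 :=
      integrable_of_le_of_le (convexOn_convHull hc).continuous_rd.aestronglyMeasurable
        (.of_forall hcle) (.of_forall (convHull_le hc)) (integrable_const c) hψρ
    exact (iInf_le _ ρ).trans
      (add_le_add_left (EReal.coe_le_coe_iff.2 (integral_mono hCρ hψρ (convHull_le hc))) _)
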